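/- Let p be a prime and let E/F be a finite totally ramified extension of p-adic fields (finite extensions of ℚ_p) such that F contains a primitive p-th root of unity. If α ∈ O_E^× is a p-primary unit of E, then N_{E/F}(α) is a p-primary unit of F. -/

import Mathlib

set_option synthInstance.maxHeartbeats 1000000
set_option maxHeartbeats 1000000
noncomputable section

namespace PadicStmt

variable (p : ℕ) [Fact p.Prime]

/-- The `ℤ_[p]`-algebra structure on a `ℚ_[p]`-algebra. -/
noncomputable instance zpAlgebra (K : Type) [Field K] [Algebra ℚ_[p] K] :
    Algebra ℤ_[p] K :=
  ((algebraMap ℚ_[p] K).comp (algebraMap ℤ_[p] ℚ_[p])).toAlgebra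

instance zpTower (K : Type) [Field K] [Algebra ℚ_[p] K] :
    IsScalarTower ℤ_[p] ℚ_[p] K :=
  IsScalarTower.of_algebraMap_eq fun _ => rfl

instance zpTower' (K L : Type) [Field K] [Field L] [Algebra ℚ_[p] K] [Algebra ℚ_[p] L]
    [Algebra K L] [IsScalarTower ℚ_[p] K L] : IsScalarTower ℤ_[p] K L :=
  IsScalarTower.of_algebraMap_eq fun x => by
    rw [IsScalarTower.algebraMap_apply ℤ_[p] ℚ_[p] L, IsScalarTower.algebraMap_apply ℚ_[p] K L,
      IsScalarTower.algebraMap_apply ℤ_[p] ℚ_[p] K]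

/-- The ring of integers of a `p`-adic field `K`, i.e. the integral closure of `ℤ_[p]` in `K`. -/
abbrev O (K : Type) [Field K] [Algebra ℚ_[p] K] := integralClosure ℤ_[p] K

/-- The natural map `O_K → O_L` for an extension `L/K` of `p`-adic fields. -/
def intMap (K L : Type) [Field K] [Field L] [Algebra ℚ_[p] K] [Algebra ℚ_[p] L]
    [Algebra K L] [IsScalarTower ℚ_[p] K L] : O p K →+* O p L where
  toFun x := ⟨algebraMap K L x.1, IsIntegral.map (IsScalarTower.toAlgHom ℤ_[p] K L) x.2⟩
  map_one' := Subtype.ext (map_one _)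
  map_mul' x y := Subtype.ext (map_mul _ _ _)
  map_zero' := Subtype.ext (map_zero _)
  map_add' x y := Subtype.ext (map_add _ _ _)

/-- The maximal ideal of the ring of integers of a `p`-adic field, described as the
Jacobson radical of `⊥`. -/
def maxIdeal (K : Type) [Field K] [Algebra ℚ_[p] K] : Ideal (O p K) :=
  (⊥ : Ideal (O p K)).jacobson

/-- `v_K x ≥ n`:  `x` is integral and lies in the `n`-th power of the maximal ideal. -/
def ValGE (K : Type) [Field K] [Algebra ℚ_[p] K] (n : ℕ) (x : K) : Prop :=
  ∃ y : O p K, (y : K) = x ∧ y ∈ (maxIdeal p K) ^ n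

/-- `x : K` is a unit of the ring of integers `O_K`. -/
def IsIntegralUnit (K : Type) [Field K] [Algebra ℚ_[p] K] (x : K) : Prop :=
  ∃ u : (O p K)ˣ, ((u : O p K) : K) = x

/-- `x ∈ U_{n,K}`, the `n`-th unit group: `x` is a unit of `O_K` and `v_K (1 - x) ≥ n`. -/
def InU (K : Type) [Field K] [Algebra ℚ_[p] K] (n : ℕ) (x : K) : Prop :=
  IsIntegralUnit p K x ∧ ValGE p K n (1 - x)

/-- An extension `L/K` of `p`-adic fields is unramified iff `m_K O_L = m_L`
(i.e. the ramification index is `1`; the residue extension is automatically separable). -/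
def IsUnramifiedExt (K L : Type) [Field K] [Field L] [Algebra ℚ_[p] K] [Algebra ℚ_[p] L]
    [Algebra K L] [IsScalarTower ℚ_[p] K L] : Prop :=
  Ideal.map (intMap p K L) (maxIdeal p K) = maxIdeal p L

/-- An extension `L/K` of `p`-adic fields is totally ramified iff its residue degree is `1`,
i.e. `O_L = O_K + m_L`. -/
def IsTotallyRamifiedExt (K L : Type) [Field K] [Field L] [Algebra ℚ_[p] K] [Algebra ℚ_[p] L]
    [Algebra K L] [IsScalarTower ℚ_[p] K L] : Prop :=
  ∀ x : O p L, ∃ y : O p K, x - intMap p K L y ∈ maxIdeal p L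

/-- A witness that `α : K` acquires an `n`-th root in some unramified extension of `K`. -/
structure UnramifiedRootWitness (K : Type) [Field K] [Algebra ℚ_[p] K] (n : ℕ) (α : K) where
  L : Type
  [fieldL : Field L]
  [algQL : Algebra ℚ_[p] L]
  [algKL : Algebra K L]
  [tower : IsScalarTower ℚ_[p] K L]
  [fin : FiniteDimensional ℚ_[p] L]
  β : L
  pow_eq : β ^ n = algebraMap K L α
  unram : IsUnramifiedExt p K L

/-- A unit `α` of `O_K` is `p`-primary if `K(α^{1/p})/K` is unramified, equivalently `α`
admits a `p`-th root in an unramified extension of `K`. -/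
def IsPPrimary (K : Type) [Field K] [Algebra ℚ_[p] K] (α : K) : Prop :=
  IsIntegralUnit p K α ∧ Nonempty (UnramifiedRootWitness p K p α)

end PadicStmt

namespace PadicStmt

section SingleField

variable (p : ℕ) [Fact p.Prime] (K : Type) [Field K] [Algebra ℚ_[p] K]
  [FiniteDimensional ℚ_[p] K]

/-- The multiplicative norm on a finite extension of `ℚ_[p]` extending the `p`-adic norm. -/
def absv : MulAlgebraNorm ℚ_[p] K := spectralMulAlgNorm ℚ_[p] K

variable {K}

theorem absv_add_le (x y : K) : absv p K (x + y) ≤ max (absv p K x) (absv p K y) :=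
  isNonarchimedean_spectralNorm (K := ℚ_[p]) (L := K) x y

theorem absv_algebraMap (x : ℚ_[p]) : absv p K (algebraMap ℚ_[p] K x) = ‖x‖ :=
  spectralNorm_extends (K := ℚ_[p]) (L := K) x

theorem isIntegral_iff_absv_le_one (x : K) : IsIntegral ℤ_[p] x ↔ absv p K x ≤ 1 := by
  have hx : IsIntegral ℚ_[p] x := Algebra.IsIntegral.isIntegral x
  change _ ↔ spectralValue (minpoly ℚ_[p] x) ≤ 1
  rw [spectralValue_le_one_iff (minpoly.monic hx)]
  constructor
  · intro h n
    rw [minpoly.isIntegrallyClosed_eq_field_fractions' ℚ_[p] h, Polynomial.coeff_map]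
    exact PadicInt.norm_le_one _
  · intro h
    have hl : minpoly ℚ_[p] x ∈ Polynomial.lifts (algebraMap ℤ_[p] ℚ_[p]) := by
      rw [Polynomial.lifts_iff_coeff_lifts]
      intro n
      exact ⟨⟨_, h n⟩, rfl⟩
    obtain ⟨g, hg, -, hgm⟩ := Polynomial.lifts_and_natDegree_eq_and_monic hl (minpoly.monic hx)
    refine ⟨g, hgm, ?_⟩
    have := minpoly.aeval ℚ_[p] x
    rw [← hg, Polynomial.aeval_map_algebraMap] at this
    exact this

theorem absv_coe_le_one (x : O p K) : absv p K x ≤ 1 :=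
  (isIntegral_iff_absv_le_one p _).1 x.2

theorem isUnit_iff_absv (x : O p K) : IsUnit x ↔ absv p K x = 1 := by
  constructor
  · rintro ⟨u, rfl⟩
    have h : absv p K ((u : O p K) : K) * absv p K ((↑u⁻¹ : O p K) : K) = 1 := by
      rw [← map_mul, ← Subalgebra.coe_mul, Units.mul_inv, Subalgebra.coe_one, map_one]
    have h1 := absv_coe_le_one p (u : O p K)
    have h2 := absv_coe_le_one p (↑u⁻¹ : O p K)
    have h0 := apply_nonneg (absv p K) ((u : O p K) : K)
    nlinarith
  · intro h
    have hx : (x : K) ≠ 0 := by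
      intro h0
      rw [h0, map_zero] at h
      exact zero_ne_one h
    have hi : absv p K (x : K)⁻¹ ≤ 1 := by
      have : absv p K (x : K) * absv p K (x : K)⁻¹ = 1 := by
        rw [← map_mul, mul_inv_cancel₀ hx, map_one]
      rw [h, one_mul] at this
      exact this.le
    exact IsUnit.of_mul_eq_one ⟨_, (isIntegral_iff_absv_le_one p _).2 hi⟩
      (Subtype.ext (mul_inv_cancel₀ hx))

theorem mem_nonunits_iff_absv (x : O p K) : x ∈ nonunits (O p K) ↔ absv p K x < 1 := by
  rw [mem_nonunits_iff, isUnit_iff_absv, lt_iff_le_and_ne]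
  simp [absv_coe_le_one]

instance isLocalRing_O : IsLocalRing (O p K) :=
  IsLocalRing.of_nonunits_add fun a b ha hb => by
    rw [mem_nonunits_iff_absv] at *
    exact (absv_add_le p (a : K) b).trans_lt (max_lt ha hb)

theorem maxIdeal_eq : maxIdeal p K = IsLocalRing.maximalIdeal (O p K) :=
  IsLocalRing.jacobson_eq_maximalIdeal _ bot_ne_top

theorem mem_maxIdeal_iff (x : O p K) : x ∈ maxIdeal p K ↔ absv p K x < 1 := by
  rw [maxIdeal_eq, IsLocalRing.mem_maximalIdeal, mem_nonunits_iff_absv]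

theorem notMem_maxIdeal_iff (x : O p K) : x ∉ maxIdeal p K ↔ absv p K x = 1 := by
  rw [mem_maxIdeal_iff, not_lt]
  exact ⟨fun h => le_antisymm (absv_coe_le_one p x) h, fun h => h.ge⟩

instance finite_O : Module.Finite ℤ_[p] (O p K) :=
  IsIntegralClosure.finite ℤ_[p] ℚ_[p] K (O p K)

end SingleField

end PadicStmt

namespace PadicStmt

/-- A finite free module over an adically complete ring is precomplete. -/
theorem isPrecomplete_of_free_finite {R M : Type*} [CommRing R] [AddCommGroup M] [Module R M]
    (I : Ideal R) [IsPrecomplete I R] [Module.Free R M] [Module.Finite R M] :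
    IsPrecomplete I M := by
  refine ⟨fun f hf => ?_⟩
  let b := Module.Free.chooseBasis R M
  have hcoord : ∀ i, ∃ l : R, ∀ n, b.coord i (f n) ≡ l [SMOD (I ^ n • ⊤ : Submodule R R)] := by
    intro i
    refine IsPrecomplete.prec' _ fun {m n} hmn => ?_
    have h := (SModEq.sub_mem.1 (hf hmn))
    rw [SModEq.sub_mem, ← map_sub]
    have := Submodule.mem_map_of_mem (f := b.coord i) h
    rw [Submodule.map_smul''] at this
    exact Submodule.smul_mono le_rfl le_top this
  choose l hl using hcoord
  refine ⟨∑ i, l i • b i, fun n => ?_⟩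
  rw [SModEq.sub_mem]
  nth_rewrite 1 [← b.sum_repr (f n)]
  rw [← Finset.sum_sub_distrib]
  refine Submodule.sum_mem _ fun i _ => ?_
  rw [← sub_smul]
  refine Submodule.smul_mem_smul ?_ Submodule.mem_top
  have := SModEq.sub_mem.1 (hl i n)
  simpa using this

section SingleField

variable (p : ℕ) [Fact p.Prime] {K : Type} [Field K] [Algebra ℚ_[p] K]
  [FiniteDimensional ℚ_[p] K]

instance isAdicComplete_O :
    IsAdicComplete ((IsLocalRing.maximalIdeal ℤ_[p]).map (algebraMap ℤ_[p] (O p K))) (O p K) := by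
  have : Module.IsTorsionFree ℤ_[p] (O p K) := by
    have : Module.IsTorsionFree ℤ_[p] K := by
      have : FaithfulSMul ℤ_[p] K := by
        rw [faithfulSMul_iff_algebraMap_injective]
        exact (algebraMap ℚ_[p] K).injective.comp (IsFractionRing.injective ℤ_[p] ℚ_[p])
      infer_instance
    infer_instance
  have h1 : IsPrecomplete (IsLocalRing.maximalIdeal ℤ_[p]) (O p K) :=
    isPrecomplete_of_free_finite _
  have h2 : IsHausdorff (IsLocalRing.maximalIdeal ℤ_[p]) (O p K) := inferInstance
  exact { toIsHausdorff := IsHausdorff.map_algebraMap_iff.2 h2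
          toIsPrecomplete := IsPrecomplete.map_algebraMap_iff.2 h1 }

theorem exists_pow_mem_map_of_mem_maximalIdeal {x : O p K}
    (hx : x ∈ IsLocalRing.maximalIdeal (O p K)) :
    ∃ n, x ^ n ∈ (IsLocalRing.maximalIdeal ℤ_[p]).map (algebraMap ℤ_[p] (O p K)) := by
  rw [← maxIdeal_eq, mem_maxIdeal_iff] at hx
  have hp0 : (p : ℚ_[p]) ≠ 0 := by exact_mod_cast (Fact.out : p.Prime).ne_zero
  obtain ⟨n, hn⟩ := exists_pow_lt_of_lt_one (norm_pos_iff.2 hp0) hx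
  have hint : IsIntegral ℤ_[p] ((algebraMap ℚ_[p] K (p : ℚ_[p])⁻¹) * (x : K) ^ n) := by
    rw [isIntegral_iff_absv_le_one, map_mul, map_pow, absv_algebraMap, norm_inv,
      inv_mul_le_iff₀ (norm_pos_iff.2 hp0), mul_one]
    exact hn.le
  refine ⟨n, ?_⟩
  have : x ^ n = algebraMap ℤ_[p] (O p K) p * ⟨_, hint⟩ := by
    apply Subtype.ext
    have : ((algebraMap ℤ_[p] (O p K) p : O p K) : K) = algebraMap ℚ_[p] K (p : ℚ_[p]) := by
      simp
    rw [Subalgebra.coe_mul, this, ← mul_assoc, ← map_mul, mul_inv_cancel₀ hp0, map_one, one_mul]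
    rfl
  rw [this]
  refine Ideal.mul_mem_right _ _ (Ideal.mem_map_of_mem _ ?_)
  rw [PadicInt.maximalIdeal_eq_span_p]
  exact Ideal.mem_span_singleton_self _

open Polynomial in
instance henselianLocalRing_O : HenselianLocalRing (O p K) where
  is_henselian f hf a₀ h₁ h₂ := by
    set I := (IsLocalRing.maximalIdeal ℤ_[p]).map (algebraMap ℤ_[p] (O p K)) with hI
    let π := Ideal.Quotient.mk I
    have hIm : I ≤ IsLocalRing.maximalIdeal (O p K) := by
      rw [← maxIdeal_eq]
      exact IsAdicComplete.le_jacobson_bot I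
    obtain ⟨n, hn⟩ := exists_pow_mem_map_of_mem_maximalIdeal p h₁
    have hae : ∀ (q : (O p K)[X]) (a : O p K), aeval (π a) q = π (q.eval a) := fun q a => by
      rw [← Polynomial.coe_aeval_eq_eval]
      exact (aeval_algebraMap_apply _ a q)
    obtain ⟨r, ⟨hr1, hr2⟩, -⟩ := existsUnique_nilpotent_sub_and_aeval_eq_zero (P := f) (x := π a₀)
      ⟨n, by rw [hae, ← map_pow]; exact Ideal.Quotient.eq_zero_iff_mem.2 hn⟩
      (by rw [hae]; exact h₂.map π)
    obtain ⟨a₁, rfl⟩ := Ideal.Quotient.mk_surjective r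
    have hclose : ∀ a b : O p K, IsNilpotent (π a - π b) →
        a - b ∈ IsLocalRing.maximalIdeal (O p K) := by
      rintro a b ⟨k, hk⟩
      rw [← map_sub, ← map_pow] at hk
      exact Ideal.IsPrime.mem_of_pow_mem inferInstance k
        (hIm (Ideal.Quotient.eq_zero_iff_mem.1 hk))
    have h01 := hclose _ _ hr1
    have hder : IsUnit (f.derivative.eval a₁) := by
      by_contra hcon
      have h3 : f.derivative.eval a₀ - f.derivative.eval a₁ ∈ IsLocalRing.maximalIdeal (O p K) :=
        Ideal.mem_of_dvd _ (sub_dvd_eval_sub a₀ a₁ f.derivative) h01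
      have h4 := Ideal.add_mem _ h3 ((IsLocalRing.mem_maximalIdeal _).2 hcon)
      rw [sub_add_cancel] at h4
      exact (IsLocalRing.mem_maximalIdeal _).1 h4 h₂
    obtain ⟨a, ha, haa⟩ := HenselianRing.is_henselian (I := I) f hf a₁
      (Ideal.Quotient.eq_zero_iff_mem.1 (by rw [← hae]; exact hr2)) (hder.map π)
    refine ⟨a, ha, ?_⟩
    have := Ideal.sub_mem _ (hIm haa) h01
    have h5 : a - a₀ = a - a₁ - (a₀ - a₁) := by ring
    rwa [h5]

end SingleField

end PadicStmt

namespace PadicStmt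

section Extension

variable (p : ℕ) [Fact p.Prime] {K L : Type} [Field K] [Field L] [Algebra ℚ_[p] K]
  [Algebra ℚ_[p] L] [Algebra K L] [IsScalarTower ℚ_[p] K L]

@[simp]
theorem coe_intMap (x : O p K) : (intMap p K L x : L) = algebraMap K L x := rfl

variable [FiniteDimensional ℚ_[p] K] [FiniteDimensional ℚ_[p] L]

theorem absv_algebraMap_ext (x : K) : absv p L (algebraMap K L x) = absv p K x := by
  change spectralNorm ℚ_[p] L _ = spectralNorm ℚ_[p] K _
  exact (spectralNorm.eq_of_tower (K := ℚ_[p]) (E := K) (L := L) x).symm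

theorem intMap_mem_maxIdeal_iff (x : O p K) :
    intMap p K L x ∈ maxIdeal p L ↔ x ∈ maxIdeal p K := by
  rw [mem_maxIdeal_iff, mem_maxIdeal_iff, coe_intMap, absv_algebraMap_ext]

theorem exists_mul_isIntegral (x : L) :
    ∃ s : K, s ≠ 0 ∧ IsIntegral ℤ_[p] (algebraMap K L s * x) := by
  have hp0 : (p : ℚ_[p]) ≠ 0 := by exact_mod_cast (Fact.out : p.Prime).ne_zero
  by_cases hx : x = 0
  · exact ⟨1, one_ne_zero, by rw [hx, mul_zero]; exact isIntegral_zero⟩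
  have hpos : 0 < absv p L x :=
    (apply_nonneg _ _).lt_of_ne' fun h => hx (eq_zero_of_map_eq_zero _ h)
  obtain ⟨n, hn⟩ := exists_pow_lt_of_lt_one (inv_pos.2 hpos) (Padic.norm_p_lt_one (p := p))
  refine ⟨algebraMap ℚ_[p] K (p : ℚ_[p]) ^ n, pow_ne_zero _ ((map_ne_zero _).2 hp0), ?_⟩
  rw [isIntegral_iff_absv_le_one, map_mul, absv_algebraMap_ext, map_pow, absv_algebraMap]
  exact (mul_le_mul_of_nonneg_right hn.le hpos.le).trans_eq (inv_mul_cancel₀ hpos.ne')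

section Family

variable {ι : Type} [Fintype ι] {v : ι → O p L}

/-- If integral elements are linearly independent over the residue field, then the absolute
value of each coefficient of a linear combination is bounded by that of the combination. -/
theorem absv_coeff_le (hv : ∀ c : ι → O p K, ∑ i, intMap p K L (c i) * v i ∈ maxIdeal p L →
    ∀ i, c i ∈ maxIdeal p K) (a : ι → K) (i : ι) :
    absv p K (a i) ≤ absv p L (∑ i, a i • (v i : L)) := by
  obtain ⟨j, -, hj⟩ := Finset.exists_max_image Finset.univ (fun i => absv p K (a i))
    ⟨i, Finset.mem_univ i⟩
  refine (hj i (Finset.mem_univ i)).trans ?_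
  by_cases h0 : a j = 0
  · rw [h0, map_zero]
    exact apply_nonneg _ _
  have hpos : 0 < absv p K (a j) :=
    (apply_nonneg _ _).lt_of_ne' fun h => h0 (eq_zero_of_map_eq_zero _ h)
  have hc : ∀ i, IsIntegral ℤ_[p] (a i * (a j)⁻¹) := by
    intro i
    rw [isIntegral_iff_absv_le_one]
    have h1 : absv p K (a i * (a j)⁻¹) * absv p K (a j) = absv p K (a i) := by
      rw [← map_mul, inv_mul_cancel_right₀ h0]
    have h2 := hj i (Finset.mem_univ i)
    rw [← h1] at h2
    exact le_of_mul_le_mul_right (by simpa using h2) hpos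
  let c : ι → O p K := fun i => ⟨_, hc i⟩
  have hcj : c j = 1 := Subtype.ext (mul_inv_cancel₀ h0)
  have hnot : ∑ i, intMap p K L (c i) * v i ∉ maxIdeal p L := by
    intro h
    have := hv c h j
    rw [hcj, mem_maxIdeal_iff, Subalgebra.coe_one, map_one] at this
    exact lt_irrefl _ this
  rw [notMem_maxIdeal_iff] at hnot
  have hsum : ∑ i, a i • (v i : L) =
      algebraMap K L (a j) * ((∑ i, intMap p K L (c i) * v i : O p L) : L) := by
    rw [AddSubmonoidClass.coe_finsetSum, Finset.mul_sum]
    refine Finset.sum_congr rfl fun i _ => ?_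
    rw [Subalgebra.coe_mul, coe_intMap, ← mul_assoc, ← map_mul, Algebra.smul_def]
    congr 2
    change a i = a j * (a i * (a j)⁻¹)
    field_simp
  rw [hsum, map_mul, hnot, mul_one, absv_algebraMap_ext]

theorem linearIndependent_of_residue
    (hv : ∀ c : ι → O p K, ∑ i, intMap p K L (c i) * v i ∈ maxIdeal p L →
      ∀ i, c i ∈ maxIdeal p K) : LinearIndependent K (fun i => (v i : L)) := by
  rw [Fintype.linearIndependent_iff]
  intro a ha i
  have := absv_coeff_le p hv a i
  rw [ha, map_zero] at this
  exact eq_zero_of_map_eq_zero _ (le_antisymm this (apply_nonneg _ _))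

theorem isUnramifiedExt_of_residue
    (hv : ∀ c : ι → O p K, ∑ i, intMap p K L (c i) * v i ∈ maxIdeal p L →
      ∀ i, c i ∈ maxIdeal p K)
    (hs : Submodule.span K (Set.range fun i => (v i : L)) = ⊤) : IsUnramifiedExt p K L := by
  apply le_antisymm
  · rw [Ideal.map_le_iff_le_comap]
    exact fun x hx => (intMap_mem_maxIdeal_iff p x).2 hx
  · intro x hx
    obtain ⟨a, ha⟩ := (Submodule.mem_span_range_iff_exists_fun K).1
      (hs ▸ Submodule.mem_top : (x : L) ∈ _)
    have hlt : ∀ i, absv p K (a i) < 1 := fun i =>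
      (absv_coeff_le p hv a i).trans_lt (by rw [ha]; exact (mem_maxIdeal_iff p x).1 hx)
    have hx' : x = ∑ i, intMap p K L ⟨a i, (isIntegral_iff_absv_le_one p _).2 (hlt i).le⟩ * v i := by
      apply Subtype.ext
      rw [← ha, AddSubmonoidClass.coe_finsetSum]
      exact Finset.sum_congr rfl fun i _ => Algebra.smul_def _ _
    rw [hx']
    exact Submodule.sum_mem _ fun i _ => Ideal.mul_mem_right _ _
      (Ideal.mem_map_of_mem _ ((mem_maxIdeal_iff p _).2 (hlt i)))

theorem span_eq_top_of_residue (hur : IsUnramifiedExt p K L)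
    (hv : ∀ x : O p L, ∃ c : ι → O p K, x - ∑ i, intMap p K L (c i) * v i ∈ maxIdeal p L) :
    Submodule.span K (Set.range fun i => (v i : L)) = ⊤ := by
  let : Algebra (O p K) (O p L) := (intMap p K L).toAlgebra
  have hsmul : ∀ (a : O p K) (x : O p L), a • x = intMap p K L a * x := fun _ _ => rfl
  have : IsScalarTower ℤ_[p] (O p K) (O p L) := IsScalarTower.of_algebraMap_eq fun x =>
    Subtype.ext (IsScalarTower.algebraMap_apply ℤ_[p] K L x)
  have : Module.Finite (O p K) (O p L) := Module.Finite.of_restrictScalars_finite ℤ_[p] _ _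
  have hint : (⊤ : Submodule (O p K) (O p L)) ≤ Submodule.span (O p K) (Set.range v) := by
    refine Submodule.le_of_le_smul_of_le_jacobson_bot (I := maxIdeal p K)
      Module.Finite.fg_top le_rfl fun x _ => ?_
    obtain ⟨c, hc⟩ := hv x
    rw [← sub_add_cancel x (∑ i, intMap p K L (c i) * v i), add_comm]
    refine Submodule.add_mem_sup (Submodule.sum_mem _ fun i _ => ?_) ?_
    · exact Submodule.smul_mem _ (c i) (Submodule.subset_span ⟨i, rfl⟩)
    · have : maxIdeal p L = Ideal.map (algebraMap (O p K) (O p L)) (maxIdeal p K) := hur.symm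
      rw [this] at hc
      rw [Ideal.smul_top_eq_map]
      exact hc
  rw [eq_top_iff]
  intro x _
  obtain ⟨s, hs0, hs⟩ := exists_mul_isIntegral p (K := K) x
  obtain ⟨a, ha⟩ := (Submodule.mem_span_range_iff_exists_fun (O p K)).1
    (hint (Submodule.mem_top : (⟨_, hs⟩ : O p L) ∈ ⊤))
  have hsx : s • x ∈ Submodule.span K (Set.range fun i => (v i : L)) := by
    have := congrArg (fun z : O p L => (z : L)) ha
    simp only [hsmul, AddSubmonoidClass.coe_finsetSum, Subalgebra.coe_mul, coe_intMap] at this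
    rw [Algebra.smul_def, ← this]
    refine Submodule.sum_mem _ fun i _ => ?_
    rw [← Algebra.smul_def]
    exact Submodule.smul_mem _ _ (Submodule.subset_span ⟨i, rfl⟩)
  exact (Submodule.smul_mem_iff _ hs0).1 hsx

end Family

open Polynomial IsLocalRing in
/-- The residue extension has a power basis which lifts to the powers of an integral root
of a monic polynomial over the base. -/
theorem exists_residue_powerBasis_lift :
    ∃ (g : (O p K)[X]) (ω : O p L), g.Monic ∧ g.eval₂ (intMap p K L) ω = 0 ∧
      (∀ c : Fin g.natDegree → O p K, ∑ i, intMap p K L (c i) * ω ^ (i : ℕ) ∈ maxIdeal p L →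
        ∀ i, c i ∈ maxIdeal p K) ∧
      ∀ x : O p L, ∃ c : Fin g.natDegree → O p K,
        x - ∑ i, intMap p K L (c i) * ω ^ (i : ℕ) ∈ maxIdeal p L := by
  let : Algebra (O p K) (O p L) := (intMap p K L).toAlgebra
  have hlocal : IsLocalHom (algebraMap (O p K) (O p L)) := ⟨fun x hx => by
    rw [isUnit_iff_absv] at hx ⊢
    rw [← hx]
    exact (absv_algebraMap_ext p (x : K)).symm⟩
  have hlocal' : IsLocalHom (algebraMap ℤ_[p] (O p L)) := ⟨fun x hx => by
    rw [isUnit_iff_absv] at hx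
    rw [PadicInt.isUnit_iff, ← hx]
    exact (absv_algebraMap p (K := L) (x : ℚ_[p])).symm⟩
  have : Finite (ResidueField ℤ_[p]) := .of_equiv _ (PadicInt.residueField (p := p)).symm.toEquiv
  have : Finite (ResidueField (O p L)) := ResidueField.finite_of_finite (R := ℤ_[p]) this
  have : Finite (ResidueField (O p K)) :=
    .of_injective _ (algebraMap (ResidueField (O p K)) (ResidueField (O p L))).injective
  have hres : ∀ x : O p K, residue (O p L) (intMap p K L x) =
      algebraMap (ResidueField (O p K)) (ResidueField (O p L)) (residue _ x) := fun _ => rfl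
  let pb := Field.powerBasisOfFiniteOfSeparable (ResidueField (O p K)) (ResidueField (O p L))
  have hpbm := pb.isIntegral_gen
  obtain ⟨g, hg, hgd, hgm⟩ := lifts_and_natDegree_eq_and_monic
    (f := residue (O p K)) (p := minpoly (ResidueField (O p K)) pb.gen)
    ((mem_lifts _).2 (map_surjective _ residue_surjective _)) (minpoly.monic hpbm)
  have hdim : g.natDegree = pb.dim := by rw [hgd, pb.natDegree_minpoly]
  have heval : ∀ (q : (O p K)[X]) (a : O p L), residue _ ((q.map (intMap p K L)).eval a) =
      aeval (residue _ a) (q.map (residue (O p K))) := by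
    intro q a
    rw [aeval_def, eval₂_map, eval_map, hom_eval₂]
    rfl
  obtain ⟨a₀, ha₀⟩ := residue_surjective (R := O p L) pb.gen
  have hroot : (g.map (intMap p K L)).eval a₀ ∈ maximalIdeal (O p L) := by
    rw [← residue_eq_zero_iff, heval, ha₀, hg, minpoly.aeval]
  have hder : IsUnit ((g.map (intMap p K L)).derivative.eval a₀) := by
    rw [← residue_ne_zero_iff_isUnit, derivative_map, heval, ha₀, ← derivative_map, hg]
    exact (Algebra.IsSeparable.isSeparable _ pb.gen).aeval_derivative_ne_zero (minpoly.aeval _ _)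
  obtain ⟨ω, hω, hωa⟩ := HenselianLocalRing.is_henselian _ (hgm.map (intMap p K L)) a₀ hroot hder
  have hωr : residue _ ω = pb.gen := by
    rw [← ha₀, ← sub_eq_zero, ← map_sub, residue_eq_zero_iff]
    exact hωa
  have hsum : ∀ c : Fin g.natDegree → O p K,
      residue _ (∑ i, intMap p K L (c i) * ω ^ (i : ℕ)) =
        ∑ i, residue _ (c (finCongr hdim.symm i)) • pb.basis i := by
    intro c
    rw [map_sum, ← (finCongr hdim.symm).sum_comp]
    refine Finset.sum_congr rfl fun i _ => ?_
    rw [map_mul, map_pow, hωr, hres, Algebra.smul_def, pb.basis_eq_pow]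
    rfl
  refine ⟨g, ω, hgm, by rw [← eval_map]; exact hω, fun c hc i => ?_, fun x => ?_⟩
  · rw [maxIdeal_eq, ← residue_eq_zero_iff, hsum] at hc
    have := Fintype.linearIndependent_iff.1 pb.basis.linearIndependent _ hc (finCongr hdim i)
    rw [maxIdeal_eq, ← residue_eq_zero_iff]
    simpa using this
  · choose r hr using residue_surjective (R := O p K)
    refine ⟨fun i => r (pb.basis.repr (residue _ x) (finCongr hdim i)), ?_⟩
    rw [maxIdeal_eq, ← residue_eq_zero_iff, map_sub, hsum, sub_eq_zero]
    simp only [hr]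
    simpa using (pb.basis.sum_repr (residue _ x)).symm

end Extension

end PadicStmt

namespace PadicStmt

theorem isIntegralUnit_norm (p : ℕ) [Fact p.Prime] {F E : Type} [Field F] [Field E]
    [Algebra ℚ_[p] F] [Algebra ℚ_[p] E] [Algebra F E] [IsScalarTower ℚ_[p] F E]
    [FiniteDimensional ℚ_[p] F] [FiniteDimensional ℚ_[p] E] {α : E}
    (hα : IsIntegralUnit p E α) : IsIntegralUnit p F (Algebra.norm F α) := by
  have : FiniteDimensional F E := .right ℚ_[p] F E
  obtain ⟨u, rfl⟩ := hα
  refine ⟨⟨⟨_, Algebra.isIntegral_norm F (u : O p E).2⟩,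
    ⟨_, Algebra.isIntegral_norm F (↑u⁻¹ : O p E).2⟩, Subtype.ext ?_, Subtype.ext ?_⟩, rfl⟩
  · change Algebra.norm F _ * Algebra.norm F _ = 1
    rw [← map_mul, ← Subalgebra.coe_mul, Units.mul_inv, Subalgebra.coe_one, map_one]
  · change Algebra.norm F _ * Algebra.norm F _ = 1
    rw [← map_mul, ← Subalgebra.coe_mul, Units.inv_mul, Subalgebra.coe_one, map_one]

open Polynomial in
theorem aeval_mem_span_pow {R S : Type*} [CommRing R] [CommRing S] [Algebra R S] {x : S}
    {g : R[X]} {n : ℕ} (hg : g.Monic) (hn : g.natDegree = n) (hx : aeval x g = 0) (q : R[X]) :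
    aeval x q ∈ Submodule.span R (Set.range fun i : Fin n => x ^ (i : ℕ)) := by
  rw [← aeval_modByMonic_eq_self_of_root hx,
    ← sum_modByMonic_coeff hg (n := n) (hn ▸ degree_le_natDegree), map_sum]
  refine Submodule.sum_mem _ fun i _ => ?_
  rw [aeval_monomial, ← Algebra.smul_def]
  exact Submodule.smul_mem _ _ (Submodule.subset_span ⟨i, rfl⟩)

open IntermediateField in
/-- If `L = E(ω)` and the powers `ω ^ i`, `i < n`, span `F(ω)` over `F` and are linearly
independent over `E`, then the norms of `L / F(ω)` and of `E / F` agree on `E`. -/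
theorem norm_adjoin_simple_algebraMap {F E L : Type*} [Field F] [Field E] [Field L] [Algebra F E]
    [Algebra F L] [Algebra E L] [IsScalarTower F E L] [FiniteDimensional F L] {ω : L} {n : ℕ}
    (b : Module.Basis (Fin n) F F⟮ω⟯) (hb : ∀ i, (b i : L) = ω ^ (i : ℕ))
    (hli : LinearIndependent E fun i : Fin n => ω ^ (i : ℕ))
    (hspan : Submodule.span E (Set.range fun i : Fin n => ω ^ (i : ℕ)) = ⊤) (x : E) :
    Algebra.norm F⟮ω⟯ (algebraMap E L x) = algebraMap F F⟮ω⟯ (Algebra.norm F x) := by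
  let e : E →ₐ[F] L := IsScalarTower.toAlgHom F E L
  have h₁ : F⟮ω⟯.LinearDisjoint E := by
    refine LinearDisjoint.of_basis_left b ?_
    convert hli using 2 with i
    exact hb _
  have h₁' : F⟮ω⟯.LinearDisjoint e.fieldRange := by
    rw [linearDisjoint_iff']
    exact h₁
  have h₂ : F⟮ω⟯ ⊔ e.fieldRange = ⊤ := by
    rw [eq_top_iff]
    intro y _
    obtain ⟨a, ha⟩ := (Submodule.mem_span_range_iff_exists_fun E).1
      (hspan ▸ Submodule.mem_top : y ∈ _)
    rw [← ha]
    refine sum_mem fun i _ => ?_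
    rw [Algebra.smul_def]
    refine mul_mem (le_sup_right (a := F⟮ω⟯) (⟨_, rfl⟩ : algebraMap E L (a i) ∈ e.fieldRange))
      (pow_mem (le_sup_left (b := e.fieldRange) (mem_adjoin_simple_self F ω)) _)
  have h := h₁'.norm_algebraMap h₂ (AlgEquiv.ofInjectiveField e x)
  exact h.trans (congrArg _ (Algebra.norm_eq_of_algEquiv (AlgEquiv.ofInjectiveField e) x))

end PadicStmt

open PadicStmt in
/-- Let `E/F` be a finite *totally ramified* extension of `p`-adic fields
such that `F` contains a primitive `p`-th root of unity.  If `α` is a `p`-primary unit of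
`E`, then `N_{E/F}(α)` is a `p`-primary unit of `F`. -/
theorem stmt7 (p : ℕ) [Fact p.Prime] (F E : Type) [Field F] [Field E]
    [Algebra ℚ_[p] F] [Algebra ℚ_[p] E] [Algebra F E] [IsScalarTower ℚ_[p] F E]
    [FiniteDimensional ℚ_[p] F] [FiniteDimensional ℚ_[p] E]
    (htr : IsTotallyRamifiedExt p F E)
    (ζ : F) (hζ : IsPrimitiveRoot ζ p)
    (α : E) (hα : IsPPrimary p E α) :
    IsPPrimary p F (Algebra.norm F α) := by
  obtain ⟨hu, ⟨W⟩⟩ := hα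
  refine ⟨isIntegralUnit_norm p hu, ?_⟩
  obtain ⟨L, β, hβ, hur⟩ := W
  let : Algebra F L := ((algebraMap E L).comp (algebraMap F E)).toAlgebra
  have : IsScalarTower F E L := IsScalarTower.of_algebraMap_eq fun _ => rfl
  have : IsScalarTower ℚ_[p] F L := IsScalarTower.of_algebraMap_eq fun x => by
    rw [IsScalarTower.algebraMap_apply F E L, ← IsScalarTower.algebraMap_apply ℚ_[p] F E,
      ← IsScalarTower.algebraMap_apply ℚ_[p] E L]
  have : FiniteDimensional F L := .right ℚ_[p] F L
  obtain ⟨g, ω, hgm, hgω, hind, hgen⟩ := exists_residue_powerBasis_lift p (K := F) (L := L)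
  have hcomp : ∀ x : O p F, intMap p E L (intMap p F E x) = intMap p F L x := fun _ => rfl
  have hindE : ∀ c : Fin g.natDegree → O p E,
      ∑ i, intMap p E L (c i) * ω ^ (i : ℕ) ∈ maxIdeal p L → ∀ i, c i ∈ maxIdeal p E := by
    intro c hc i
    choose y hy using fun i => htr (c i)
    have hdiff : ∑ i, intMap p E L (c i - intMap p F E (y i)) * ω ^ (i : ℕ) ∈ maxIdeal p L :=
      Submodule.sum_mem _ fun i _ =>
        Ideal.mul_mem_right _ _ ((intMap_mem_maxIdeal_iff p _).2 (hy i))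
    have hy' := hind y (by
      have := Ideal.sub_mem _ hc hdiff
      rw [← Finset.sum_sub_distrib] at this
      simpa only [← sub_mul, map_sub, sub_sub_cancel, hcomp] using this) i
    have := Ideal.add_mem _ (hy i) ((intMap_mem_maxIdeal_iff p _).2 hy' :
      intMap p F E (y i) ∈ maxIdeal p E)
    rwa [sub_add_cancel] at this
  have hspanE := span_eq_top_of_residue p (v := fun i : Fin g.natDegree => ω ^ (i : ℕ)) hur
    fun x => by
      obtain ⟨c, hc⟩ := hgen x
      exact ⟨fun i => intMap p F E (c i), hc⟩
  have hliE := linearIndependent_of_residue p hindE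
  let F' := IntermediateField.adjoin F {(ω : L)}
  have : IsScalarTower ℚ_[p] F' L := .of_algebraMap_eq fun _ => rfl
  have : FiniteDimensional ℚ_[p] F' := .left ℚ_[p] F' L
  let ω' : O p F' := ⟨IntermediateField.AdjoinSimple.gen F (ω : L), by
    have h := ω.2
    exact (isIntegral_algHom_iff (IsScalarTower.toAlgHom ℤ_[p] F' L)
      (algebraMap F' L).injective).1 h⟩
  have hindF' : ∀ c : Fin g.natDegree → O p F,
      ∑ i, intMap p F F' (c i) * ω' ^ (i : ℕ) ∈ maxIdeal p F' → ∀ i, c i ∈ maxIdeal p F := by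
    intro c hc
    refine hind c ?_
    have := (intMap_mem_maxIdeal_iff p (L := L) _).2 hc
    rw [map_sum] at this
    exact this
  have hliF' := linearIndependent_of_residue p hindF'
  have hgω' : Polynomial.aeval (ω' : F') (g.map (algebraMap (O p F) F)) = 0 := by
    apply (algebraMap F' L).injective
    rw [map_zero, ← Polynomial.aeval_algebraMap_apply, Polynomial.aeval_map_algebraMap]
    have h := congrArg (algebraMap (O p L) L) hgω
    rw [map_zero, Polynomial.hom_eval₂] at h
    exact h
  have hspanF' : Submodule.span F
      (Set.range fun i : Fin g.natDegree => ((ω' ^ (i : ℕ) : O p F') : F')) = ⊤ := by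
    rw [eq_top_iff]
    intro x _
    obtain ⟨q, rfl⟩ := (IntermediateField.adjoin.powerBasis
      (Algebra.IsIntegral.isIntegral (R := F) (ω : L))).exists_eq_aeval' x
    rw [IntermediateField.adjoin.powerBasis_gen]
    exact aeval_mem_span_pow (hgm.map (algebraMap (O p F) F)) (hgm.natDegree_map _) hgω' q
  let b := Module.Basis.mk hliF' hspanF'.ge
  have hnorm := norm_adjoin_simple_algebraMap (E := E) b
    (fun i => by rw [Module.Basis.mk_apply]; rfl) hliE hspanE α
  exact ⟨{
    L := F'
    β := Algebra.norm F' β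
    pow_eq := by rw [← map_pow, hβ, hnorm]
    unram := isUnramifiedExt_of_residue p hindF' hspanF' }⟩
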